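/- arXiv:2603.08554 — 3 statements merged into one kernel-verified Lean document; each statement's English description precedes it below -/
import Mathlib

section
/- Let f : ℝ² → ℝ be smooth and let p ∈ ℝ² be a non-degenerate critical point of f of index 1 with f(p) = 0 and ∂²f/∂y²(p) ≠ 0. Then there exist an open interval I around the first coordinate of p and two distinct smooth functions y₁, y₂ : I → ℝ such that f(x, yⱼ(x)) = 0 for all x ∈ I and j = 1,2. -/
/-- The Hessian matrix of `f : ℝ² → ℝ` at `p`, with respect to the standard basis. -/
noncomputable def hessianMatrix (f : ℝ × ℝ → ℝ) (p : ℝ × ℝ) : Matrix (Fin 2) (Fin 2) ℝ :=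
  Matrix.of fun i j =>
    iteratedFDeriv ℝ 2 f p ![![((1 : ℝ), (0 : ℝ)), ((0 : ℝ), (1 : ℝ))] i,
      ![((1 : ℝ), (0 : ℝ)), ((0 : ℝ), (1 : ℝ))] j]

open Set Filter Topology

theorem aux_hasFDerivAt_param {G : Type} [NormedAddCommGroup G] [NormedSpace ℝ G] [CompleteSpace G]
    (g : (ℝ × ℝ) × ℝ → G) (hg : ContDiff ℝ (⊤ : ℕ∞) g) (z : ℝ × ℝ) :
    HasFDerivAt (fun z => ∫ s in (0:ℝ)..1, g (z, s))
      (∫ s in (0:ℝ)..1, (fderiv ℝ g (z, s)).comp (ContinuousLinearMap.inl ℝ (ℝ × ℝ) ℝ)) z := by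
  have hgc := hg.continuous
  have hg' : Continuous (fun q : (ℝ × ℝ) × ℝ =>
      (fderiv ℝ g q).comp (ContinuousLinearMap.inl ℝ (ℝ × ℝ) ℝ)) :=
    (hg.continuous_fderiv (by simp)).clm_comp continuous_const
  obtain ⟨C, hC⟩ := ((isCompact_closedBall z 1).prod
    (isCompact_Icc (a := (0:ℝ)) (b := 1))).exists_bound_of_continuousOn hg'.continuousOn
  refine intervalIntegral.hasFDerivAt_integral_of_dominated_of_fderiv_le
    (F := fun z s => g (z, s))
    (F' := fun z s => (fderiv ℝ g (z, s)).comp (ContinuousLinearMap.inl ℝ (ℝ × ℝ) ℝ))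
    (bound := fun _ => C)
    (Metric.closedBall_mem_nhds z one_pos) ?_ ?_ ?_ ?_ ?_ ?_
  · exact Eventually.of_forall fun x => (hgc.comp (by fun_prop)).aestronglyMeasurable
  · exact (hgc.comp (by fun_prop : Continuous fun s : ℝ => (z, s))).intervalIntegrable _ _
  · exact (hg'.comp (by fun_prop : Continuous fun s : ℝ => (z, s))).aestronglyMeasurable
  · refine Eventually.of_forall fun t ht x hx => hC (x, t) ⟨hx, ?_⟩
    rw [uIoc_of_le zero_le_one] at ht
    exact ⟨ht.1.le, ht.2⟩
  · exact intervalIntegrable_const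
  · refine Eventually.of_forall fun t ht x hx => ?_
    have h1 : HasFDerivAt g (fderiv ℝ g (x, t)) (x, t) :=
      (hg.differentiable (by simp) _).hasFDerivAt
    exact h1.comp x (hasFDerivAt_prodMk_left x t)

theorem aux_contDiff_param (n : ℕ) : ∀ {G : Type} [NormedAddCommGroup G] [NormedSpace ℝ G]
    [CompleteSpace G] (g : (ℝ × ℝ) × ℝ → G), ContDiff ℝ (⊤ : ℕ∞) g →
    ContDiff ℝ n (fun z => ∫ s in (0:ℝ)..1, g (z, s)) := by
  induction n with
  | zero =>
    intro G _ _ _ g hg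
    refine contDiff_zero.2 ?_
    exact intervalIntegral.continuous_parametric_intervalIntegral_of_continuous'
      (f := fun z s => g (z, s)) hg.continuous 0 1
  | succ n ih =>
    intro G _ _ _ g hg
    push_cast
    rw [contDiff_succ_iff_hasFDerivAt]
    refine ⟨_, ?_, aux_hasFDerivAt_param g hg⟩
    refine ih (fun q => (fderiv ℝ g q).comp (ContinuousLinearMap.inl ℝ (ℝ × ℝ) ℝ)) ?_
    exact (hg.fderiv_right (m := (⊤ : ℕ∞)) (by simp)).clm_comp contDiff_const

noncomputable def auxEquiv (a d : ℝ) (hd : d ≠ 0) : (ℝ × ℝ) ≃L[ℝ] (ℝ × ℝ) :=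
  LinearEquiv.toContinuousLinearEquiv
    { toFun := fun v => (v.1, v.1 * a + v.2 * d)
      invFun := fun v => (v.1, (v.2 - v.1 * a) / d)
      map_add' := fun v w => by ext <;> simp; ring
      map_smul' := fun c v => by ext <;> simp; ring
      left_inv := fun v => by ext <;> simp [hd]
      right_inv := fun v => by ext <;> simp [hd] }

theorem aux_hasFDerivAt_graph (F : ℝ × ℝ → ℝ) (hF : ContDiff ℝ (⊤ : ℕ∞) F) (z : ℝ × ℝ)
    (hd : fderiv ℝ F z (0, 1) ≠ 0) :
    HasFDerivAt (fun z : ℝ × ℝ => (z.1, F z))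
      ((auxEquiv (fderiv ℝ F z (1, 0)) (fderiv ℝ F z (0, 1)) hd : (ℝ × ℝ) ≃L[ℝ] (ℝ × ℝ)) :
        (ℝ × ℝ) →L[ℝ] (ℝ × ℝ)) z := by
  have h1 : HasFDerivAt F (fderiv ℝ F z) z := (hF.differentiable (by simp) _).hasFDerivAt
  refine (hasFDerivAt_fst.prodMk h1).congr_fderiv ?_
  ext <;> simp [auxEquiv]

theorem aux_implicit (F : ℝ × ℝ → ℝ) (hF : ContDiff ℝ (⊤ : ℕ∞) F) (t₀ : ℝ)
    (h0 : F (0, t₀) = 0) (d : ℝ) (hd : d ≠ 0) (hder : HasDerivAt (fun t => F (0, t)) d t₀) :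
    ∃ I : Set ℝ, IsOpen I ∧ (0:ℝ) ∈ I ∧ ∃ τ : ℝ → ℝ, ContDiffOn ℝ (⊤ : ℕ∞) τ I ∧ τ 0 = t₀ ∧
      ∀ x ∈ I, F (x, τ x) = 0 := by
  have hd' : fderiv ℝ F (0, t₀) (0, 1) ≠ 0 := by
    have h1 : HasFDerivAt F (fderiv ℝ F (0, t₀)) (0, t₀) :=
      (hF.differentiable (by simp) _).hasFDerivAt
    have h2 := h1.comp_hasDerivAt t₀ ((hasDerivAt_const t₀ (0:ℝ)).prodMk (hasDerivAt_id t₀))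
    have h3 := h2.unique hder
    rw [h3]; exact hd
  have hΦ : ContDiff ℝ (⊤ : ℕ∞) (fun z : ℝ × ℝ => (z.1, F z)) := contDiff_fst.prodMk hF
  let e := (hΦ.contDiffAt (x := (0, t₀))).toOpenPartialHomeomorph _
    (aux_hasFDerivAt_graph F hF _ hd') (by simp)
  have hecoe : ∀ z, e z = (z.1, F z) := fun z => rfl
  have hs : ((0:ℝ), t₀) ∈ e.source := ContDiffAt.mem_toOpenPartialHomeomorph_source _ _ _
  have hV : IsOpen {z : ℝ × ℝ | fderiv ℝ F z (0, 1) ≠ 0} :=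
    isOpen_ne_fun ((hF.continuous_fderiv (by simp)).clm_apply continuous_const) continuous_const
  have hopen : IsOpen (e.target ∩ e.symm ⁻¹' {z : ℝ × ℝ | fderiv ℝ F z (0, 1) ≠ 0}) :=
    e.isOpen_inter_preimage_symm hV
  have he0 : e (0, t₀) = (0, 0) := by rw [hecoe, h0]
  have hsymm0 : e.symm (0, 0) = (0, t₀) := by rw [← he0, e.left_inv hs]
  have h0t : ((0:ℝ), (0:ℝ)) ∈ e.target := by rw [← he0]; exact e.map_source hs
  refine ⟨(fun x : ℝ => (x, (0:ℝ))) ⁻¹'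
    (e.target ∩ e.symm ⁻¹' {z : ℝ × ℝ | fderiv ℝ F z (0, 1) ≠ 0}),
    hopen.preimage (by fun_prop), ⟨h0t, ?_⟩, fun x => (e.symm (x, 0)).2, ?_, ?_, ?_⟩
  · show fderiv ℝ F (e.symm (0, 0)) (0, 1) ≠ 0
    rw [hsymm0]; exact hd'
  · intro x hx
    have h1 : ContDiffAt ℝ (⊤ : ℕ∞) e.symm (x, 0) :=
      e.contDiffAt_symm hx.1 (aux_hasFDerivAt_graph F hF _ hx.2) hΦ.contDiffAt
    have h2 : ContDiffAt ℝ (⊤ : ℕ∞) (fun x : ℝ => (x, (0:ℝ))) x := by fun_prop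
    exact ((h1.comp x h2).snd).contDiffWithinAt
  · show (e.symm (0, 0)).2 = t₀
    rw [hsymm0]
  · intro x hx
    have h1 := e.right_inv hx.1
    rw [hecoe] at h1
    have h2 : (e.symm (x, 0)).1 = x := congrArg Prod.fst h1
    have h3 : F (e.symm (x, 0)) = 0 := congrArg Prod.snd h1
    show F (x, (e.symm (x, 0)).2) = 0
    have h4 : (x, (e.symm (x, 0)).2) = e.symm (x, 0) := Prod.ext h2.symm rfl
    rw [h4]; exact h3

theorem aux_blowup (f : ℝ × ℝ → ℝ) (hf : ContDiff ℝ (⊤ : ℕ∞) f) (p : ℝ × ℝ)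
    (hf0 : f p = 0) (hDf : fderiv ℝ f p = 0) :
    ∃ F : ℝ × ℝ → ℝ, ContDiff ℝ (⊤ : ℕ∞) F ∧
      (∀ x t, f (p.1 + x, p.2 + x * t) = x ^ 2 * F (x, t)) ∧
      ∀ t, F (0, t) = 1 / 2 * fderiv ℝ (fderiv ℝ f) p (1, t) (1, t) := by
  have hf2 : ContDiff ℝ (⊤ : ℕ∞) (fderiv ℝ (fderiv ℝ f)) :=
    (hf.fderiv_right (m := (⊤ : ℕ∞)) (by simp)).fderiv_right (by simp)
  refine ⟨fun z => ∫ s in (0:ℝ)..1, (1 - s) *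
    fderiv ℝ (fderiv ℝ f) (p + s • (z.1, z.1 * z.2)) (1, z.2) (1, z.2), ?_, ?_, ?_⟩
  · rw [contDiff_infty]
    intro n
    refine aux_contDiff_param n (fun q : (ℝ × ℝ) × ℝ => (1 - q.2) *
      fderiv ℝ (fderiv ℝ f) (p + q.2 • (q.1.1, q.1.1 * q.1.2)) (1, q.1.2) (1, q.1.2)) ?_
    have h1 : ContDiff ℝ (⊤ : ℕ∞) (fun q : (ℝ × ℝ) × ℝ =>
        fderiv ℝ (fderiv ℝ f) (p + q.2 • (q.1.1, q.1.1 * q.1.2))) :=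
      hf2.comp (by fun_prop)
    have h2 : ContDiff ℝ (⊤ : ℕ∞) (fun q : (ℝ × ℝ) × ℝ => ((1:ℝ), q.1.2)) := by fun_prop
    exact (by fun_prop : ContDiff ℝ (⊤ : ℕ∞) (fun q : (ℝ × ℝ) × ℝ => 1 - q.2)).mul
      ((h1.clm_apply h2).clm_apply h2)
  · intro x t
    have h := map_add_eq_sum_add_integral_iteratedFDeriv (f := f) (x := p) (y := (x, x * t))
      (n := 1) (fun s _ => (hf.of_le (by norm_cast)).contDiffAt)
    simp only [Finset.sum_range_succ, Finset.sum_range_zero, iteratedFDeriv_zero_apply,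
      iteratedFDeriv_one_apply, hDf, hf0] at h
    have e1 : p + (x, x * t) = (p.1 + x, p.2 + x * t) := rfl
    rw [e1] at h
    rw [h, ← intervalIntegral.integral_const_mul]
    simp only [Nat.factorial_zero, Nat.factorial_one, Nat.cast_one, inv_one, 
      zero_apply, add_zero, zero_add, mul_zero, one_mul, pow_one, smul_eq_mul]
    refine intervalIntegral.integral_congr fun s _ => ?_
    have e2 : ((x, x * t) : ℝ × ℝ) = x • ((1:ℝ), t) := by simp
    simp only [Nat.reduceAdd, iteratedFDeriv_two_apply]
    generalize fderiv ℝ (fderiv ℝ f) (p + s • (x, x * t)) = L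
    rw [e2]
    simp only [map_smul, smul_apply, smul_eq_mul]
    ring
  · intro t
    simp only [zero_mul, Prod.mk_zero_zero, smul_zero, add_zero]
    rw [intervalIntegral.integral_mul_const]
    congr 1
    rw [intervalIntegral.integral_sub (by simp) (by simp)]
    norm_num

/-- Corollary of the Morse lemma: near a non-degenerate critical point of index 1
(for a 2×2 invertible symmetric Hessian, index 1 is equivalent to negative determinant)
with nonvanishing second partial derivative in the `y` direction, the zero set of `f`
consists of two distinct smooth graphs over `x`. -/
theorem morse_two_branches (f : ℝ × ℝ → ℝ) (hf : ContDiff ℝ (⊤ : ℕ∞) f) (p : ℝ × ℝ)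
    (hf0 : f p = 0) (hDf : fderiv ℝ f p = 0)
    (hindex : (hessianMatrix f p).det < 0)
    (hyy : hessianMatrix f p 1 1 ≠ 0) :
    ∃ I : Set ℝ, IsOpen I ∧ p.1 ∈ I ∧
      ∃ y₁ y₂ : ℝ → ℝ, ContDiffOn ℝ (⊤ : ℕ∞) y₁ I ∧ ContDiffOn ℝ (⊤ : ℕ∞) y₂ I ∧
        (∃ x ∈ I, y₁ x ≠ y₂ x) ∧
        ∀ x ∈ I, f (x, y₁ x) = 0 ∧ f (x, y₂ x) = 0 := by
  obtain ⟨F, hF, hfF, hF0⟩ := aux_blowup f hf p hf0 hDf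
  rw [Matrix.det_fin_two] at hindex
  simp only [hessianMatrix, Matrix.of_apply, iteratedFDeriv_two_apply, Matrix.cons_val_zero,
    Matrix.cons_val_one] at hindex hyy
  set L := fderiv ℝ (fderiv ℝ f) p with hL
  set a := L (1, 0) (1, 0) with ha
  set b := L (1, 0) (0, 1) with hb
  set b' := L (0, 1) (1, 0) with hb'
  set c := L (0, 1) (0, 1) with hc
  have hF0' : ∀ t, F (0, t) = 1 / 2 * (a + (b + b') * t + c * t ^ 2) := by
    intro t
    rw [hF0]
    have e : ((1:ℝ), t) = (1, 0) + t • ((0:ℝ), (1:ℝ)) := by simp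
    rw [e]
    simp only [map_add, map_smul, add_apply, smul_apply,
      smul_eq_mul, ← ha, ← hb, ← hb', ← hc]
    ring
  have hdisc : 0 < (b + b') ^ 2 - 4 * a * c := by nlinarith [sq_nonneg (b - b')]
  set r := √((b + b') ^ 2 - 4 * a * c) with hr
  have hrpos : 0 < r := Real.sqrt_pos.2 hdisc
  have hr2 : r ^ 2 = (b + b') ^ 2 - 4 * a * c := Real.sq_sqrt hdisc.le
  have key : ∀ ρ : ℝ, ρ ^ 2 = (b + b') ^ 2 - 4 * a * c → ρ ≠ 0 →
      ∃ I : Set ℝ, IsOpen I ∧ (0:ℝ) ∈ I ∧ ∃ τ : ℝ → ℝ, ContDiffOn ℝ (⊤ : ℕ∞) τ I ∧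
        τ 0 = (-(b + b') + ρ) / (2 * c) ∧ ∀ x ∈ I, F (x, τ x) = 0 := by
    intro ρ hρ hρ0
    refine aux_implicit F hF _ ?_ (1 / 2 * ρ) (by simpa using hρ0) ?_
    · rw [hF0']
      field_simp
      linear_combination hρ
    · rw [funext hF0']
      have h1 : HasDerivAt (fun t : ℝ => 1 / 2 * (a + (b + b') * t + c * t ^ 2))
          (1 / 2 * ((b + b') * 1 + c * (2 * ((-(b + b') + ρ) / (2 * c)))))
          ((-(b + b') + ρ) / (2 * c)) := by
        have hsq := hasDerivAt_pow 2 ((-(b + b') + ρ) / (2 * c))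
        have := ((((hasDerivAt_id ((-(b + b') + ρ) / (2 * c))).const_mul (b + b')).const_add
          a).add (hsq.const_mul c)).const_mul (1 / 2)
        simpa using this
      refine h1.congr_deriv ?_
      field_simp
      ring
  obtain ⟨I₁, hI₁, h01, τ₁, hτ₁, hτ₁0, hz₁⟩ := key r hr2 hrpos.ne'
  obtain ⟨I₂, hI₂, h02, τ₂, hτ₂, hτ₂0, hz₂⟩ := key (-r) (by rw [neg_sq, hr2]) (by simpa using hrpos.ne')
  have hne : τ₁ 0 ≠ τ₂ 0 := by
    rw [hτ₁0, hτ₂0]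
    intro h
    field_simp at h
    linarith
  have hsub : ContDiff ℝ (⊤ : ℕ∞) (fun x : ℝ => x - p.1) := by fun_prop
  refine ⟨(fun x => x - p.1) ⁻¹' (I₁ ∩ I₂), (hI₁.inter hI₂).preimage (by fun_prop),
    by simp [h01, h02], fun x => p.2 + (x - p.1) * τ₁ (x - p.1),
    fun x => p.2 + (x - p.1) * τ₂ (x - p.1), ?_, ?_, ?_, ?_⟩
  · exact contDiffOn_const.add (hsub.contDiffOn.mul
      (hτ₁.comp hsub.contDiffOn fun x hx => hx.1))
  · exact contDiffOn_const.add (hsub.contDiffOn.mul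
      (hτ₂.comp hsub.contDiffOn fun x hx => hx.2))
  · have c1 : ContinuousAt τ₁ 0 := hτ₁.continuousOn.continuousAt (hI₁.mem_nhds h01)
    have c2 : ContinuousAt τ₂ 0 := hτ₂.continuousOn.continuousAt (hI₂.mem_nhds h02)
    have hev : ∀ᶠ x in 𝓝 (0:ℝ), τ₁ x ≠ τ₂ x ∧ x ∈ I₁ ∩ I₂ :=
      (((c1.sub c2).eventually_ne (sub_ne_zero.2 hne)).mono fun x hx => sub_ne_zero.1 hx).and ((hI₁.inter hI₂).mem_nhds ⟨h01, h02⟩)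
    obtain ⟨u, hu, hu0⟩ := ((hev.filter_mono nhdsWithin_le_nhds).and
      (self_mem_nhdsWithin : {(0:ℝ)}ᶜ ∈ 𝓝[≠] (0:ℝ))).exists
    refine ⟨u + p.1, by simpa using hu.2, ?_⟩
    simp only [add_sub_cancel_right]
    intro h
    exact hu.1 (mul_left_cancel₀ hu0 (add_left_cancel h))
  · intro x hx
    have e : p.1 + (x - p.1) = x := by ring
    have h1 := hfF (x - p.1) (τ₁ (x - p.1))
    have h2 := hfF (x - p.1) (τ₂ (x - p.1))
    rw [hz₁ _ hx.1, mul_zero, e] at h1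
    rw [hz₂ _ hx.2, mul_zero, e] at h2
    exact ⟨h1, h2⟩
end

section
/- Let f ∈ 𝒮(ℝ) be a Schwartz function and define the Cauchy principal value γ(f,λ) = lim_{ε→0⁺} ∫_{ℝ∖(λ-ε,λ+ε)} f(x)/(x-λ) dx. Then γ(f,·) is smooth on ℝ and its k-th derivative satisfies (d^k/dλ^k) γ(f,λ) = γ(f^{(k)}, λ), where f^{(k)} is the k-th derivative of f. -/
open Filter MeasureTheory

lemma pv_bound (g : SchwartzMap ℝ ℝ) : ∃ A : ℝ, 0 ≤ A ∧ ∀ lam t : ℝ, 0 < t →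
    ‖(g (lam + t) - g (lam - t)) / t‖ ≤ A * (1 + |lam|) * (1 + t ^ 2)⁻¹ := by
  obtain ⟨C0, hC0, h0⟩ := g.decay 0 0
  obtain ⟨C1, hC1, h1⟩ := g.decay 1 0
  obtain ⟨D, hD, hd⟩ := (SchwartzMap.derivCLM ℝ ℝ g).decay 0 0
  simp only [pow_zero, one_mul, pow_one, norm_iteratedFDeriv_zero, Real.norm_eq_abs,
    SchwartzMap.derivCLM_apply] at h0 h1 hd
  refine ⟨2 * D + 2 * C1 + 2 * C0, by positivity, fun lam t ht => ?_⟩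
  have hl := abs_nonneg lam
  have hN1 : |g (lam + t) - g (lam - t)| ≤ 2 * D * t := by
    have := Convex.norm_image_sub_le_of_norm_deriv_le (f := g) (s := Set.univ) (C := D)
      (x := lam - t) (y := lam + t)
      (fun x _ => g.differentiableAt) (fun x _ => hd x) convex_univ trivial trivial
    rw [Real.norm_eq_abs, Real.norm_eq_abs, show lam + t - (lam - t) = 2 * t by ring,
      abs_of_pos (by positivity : 0 < 2 * t)] at this
    linarith
  have hN2 : t * |g (lam + t) - g (lam - t)| ≤ 2 * C1 + 2 * (|lam| * C0) := by
    have ha : t * |g (lam + t)| ≤ C1 + |lam| * C0 := by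
      have e1 : t ≤ |lam + t| + |lam| := by
        have := abs_sub (lam + t) lam
        rw [show lam + t - lam = t by ring, abs_of_pos ht] at this
        exact this
      have e2 := mul_le_mul_of_nonneg_right e1 (abs_nonneg (g (lam + t)))
      have e3 := mul_le_mul_of_nonneg_left (h0 (lam + t)) hl
      have e4 := h1 (lam + t)
      linarith
    have hb : t * |g (lam - t)| ≤ C1 + |lam| * C0 := by
      have e1 : t ≤ |lam - t| + |lam| := by
        have := abs_sub lam (lam - t)
        rw [show lam - (lam - t) = t by ring, abs_of_pos ht] at this
        linarith
      have e2 := mul_le_mul_of_nonneg_right e1 (abs_nonneg (g (lam - t)))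
      have e3 := mul_le_mul_of_nonneg_left (h0 (lam - t)) hl
      have e4 := h1 (lam - t)
      linarith
    have := mul_le_mul_of_nonneg_left (abs_sub (g (lam + t)) (g (lam - t))) ht.le
    linarith
  rw [norm_div, Real.norm_eq_abs, Real.norm_eq_abs, abs_of_pos ht, ← div_eq_mul_inv,
    div_le_div_iff₀ ht (by positivity)]
  have e := mul_le_mul_of_nonneg_left hN2 ht.le
  have p1 : 0 ≤ D * |lam| * t := by positivity
  have p2 : 0 ≤ C1 * |lam| * t := by positivity
  have p3 : 0 ≤ C0 * t := by positivity
  nlinarith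

lemma pv_meas (g : SchwartzMap ℝ ℝ) (lam : ℝ) :
    Measurable (fun t : ℝ => (g (lam + t) - g (lam - t)) / t) := by
  have := g.continuous.measurable
  fun_prop

lemma pv_integrable (g : SchwartzMap ℝ ℝ) (lam : ℝ) :
    IntegrableOn (fun t : ℝ => (g (lam + t) - g (lam - t)) / t) (Set.Ioi 0) := by
  obtain ⟨A, hA, h⟩ := pv_bound g
  refine Integrable.mono' ((integrable_inv_one_add_sq.const_mul (A * (1 + |lam|))).restrict)
    (pv_meas g lam).aestronglyMeasurable ?_
  exact (ae_restrict_mem measurableSet_Ioi).mono fun t ht => h lam t ht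

/-- The principal value as an absolutely convergent integral. -/
noncomputable def pvInt (g : SchwartzMap ℝ ℝ) (lam : ℝ) : ℝ :=
  ∫ t in Set.Ioi (0 : ℝ), (g (lam + t) - g (lam - t)) / t

lemma pv_hasDerivAt (g : SchwartzMap ℝ ℝ) (lam : ℝ) :
    HasDerivAt (pvInt g) (pvInt (SchwartzMap.derivCLM ℝ ℝ g) lam) lam := by
  obtain ⟨A, hA, h⟩ := pv_bound (SchwartzMap.derivCLM ℝ ℝ g)
  refine (hasDerivAt_integral_of_dominated_loc_of_deriv_le
    (μ := volume.restrict (Set.Ioi (0 : ℝ)))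
    (F := fun lam t => (g (lam + t) - g (lam - t)) / t)
    (F' := fun lam t => (SchwartzMap.derivCLM ℝ ℝ g (lam + t)
      - SchwartzMap.derivCLM ℝ ℝ g (lam - t)) / t)
    (bound := fun t => A * (1 + (|lam| + 1)) * (1 + t ^ 2)⁻¹)
    (Metric.ball_mem_nhds lam one_pos)
    (Eventually.of_forall fun x => (pv_meas g x).aestronglyMeasurable)
    (pv_integrable g lam)
    (pv_meas _ lam).aestronglyMeasurable ?_
    ((integrable_inv_one_add_sq.const_mul _).restrict) ?_).2
  · refine (ae_restrict_mem measurableSet_Ioi).mono fun t ht x hx => (h x t ht).trans ?_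
    have : |x| ≤ |lam| + 1 := by
      rw [Metric.mem_ball, Real.dist_eq] at hx
      have := abs_sub_abs_le_abs_sub x lam
      linarith
    gcongr
  · refine Eventually.of_forall fun t x _ => ?_
    have h1 : HasDerivAt (fun x => g (x + t)) (deriv g (x + t)) x :=
      (g.differentiableAt.hasDerivAt (x := x + t)).comp_add_const x t
    have h2 : HasDerivAt (fun x => g (x - t)) (deriv g (x - t)) x :=
      (g.differentiableAt.hasDerivAt (x := x - t)).comp_sub_const x t
    simpa [SchwartzMap.derivCLM_apply] using (h1.sub h2).div_const t

lemma pv_trunc (g : SchwartzMap ℝ ℝ) (lam ε : ℝ) (hε : 0 < ε) :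
    ∫ x in {x : ℝ | ε ≤ |x - lam|}, g x / (x - lam) =
      ∫ t in Set.Ici ε, (g (lam + t) - g (lam - t)) / t := by
  have hmeas : MeasurableSet {x : ℝ | ε ≤ |x - lam|} :=
    measurableSet_le measurable_const (by fun_prop)
  have hint : IntegrableOn (fun x => g x / (x - lam)) {x : ℝ | ε ≤ |x - lam|} := by
    refine Integrable.mono' ((g.integrable (μ := volume)).norm.div_const ε).restrict ?_ ?_
    · have := g.continuous.measurable
      exact Measurable.aestronglyMeasurable (by fun_prop)
    · refine (ae_restrict_mem hmeas).mono fun x hx => ?_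
      rw [norm_div]
      exact div_le_div_of_nonneg_left (norm_nonneg _) hε hx
  have hset : {x : ℝ | ε ≤ |x - lam|} = Set.Ici (lam + ε) ∪ Set.Iic (lam - ε) := by
    ext x
    simp only [Set.mem_ofPred_eq, Set.mem_union, Set.mem_Ici, Set.mem_Iic, le_abs]
    constructor <;> rintro (h | h) <;> [left; right; left; right] <;> linarith
  rw [hset] at hint ⊢
  have i1 := hint.mono_set Set.subset_union_left
  have i2 := hint.mono_set Set.subset_union_right
  have mp1 : MeasurePreserving (fun t : ℝ => lam + t) := measurePreserving_add_left volume lam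
  have em1 : MeasurableEmbedding (fun t : ℝ => lam + t) := measurableEmbedding_addLeft lam
  have mp2 : MeasurePreserving (fun t : ℝ => lam - t) := Measure.measurePreserving_sub_left volume lam
  have em2 : MeasurableEmbedding (fun t : ℝ => lam - t) := measurableEmbedding_subLeft lam
  have p1 : (fun t : ℝ => lam + t) ⁻¹' Set.Ici (lam + ε) = Set.Ici ε := by
    ext; simp
  have p2 : (fun t : ℝ => lam - t) ⁻¹' Set.Iic (lam - ε) = Set.Ici ε := by
    ext; simp
  have j1 := (mp1.integrableOn_comp_preimage em1).2 i1
  have j2 := (mp2.integrableOn_comp_preimage em2).2 i2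
  rw [p1] at j1
  rw [p2] at j2
  rw [setIntegral_union _ measurableSet_Iic i1 i2, ← mp1.setIntegral_preimage_emb em1 _ (Set.Ici (lam + ε)),
    ← mp2.setIntegral_preimage_emb em2 _ (Set.Iic (lam - ε)), p1, p2]
  · have := integral_add j1 j2
    simp only [Function.comp_def] at this
    rw [← this]
    refine integral_congr_ae (Eventually.of_forall fun t => ?_)
    simp only [add_sub_cancel_left, sub_sub_cancel_left, div_neg]
    ring
  · rw [Set.disjoint_left]
    intro x hx hx'
    simp only [Set.mem_Ici, Set.mem_Iic] at hx hx'
    linarith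

lemma pv_tendsto (g : SchwartzMap ℝ ℝ) (lam : ℝ) :
    Tendsto (fun ε : ℝ => ∫ x in {x : ℝ | ε ≤ |x - lam|}, g x / (x - lam))
      (nhdsWithin 0 (Set.Ioi 0)) (nhds (pvInt g lam)) := by
  have ha : Tendsto (fun ε : ℝ => ε) (nhdsWithin 0 (Set.Ioi 0)) (nhds 0) :=
    tendsto_id.mono_left nhdsWithin_le_nhds
  have := (aecover_Ioi_of_Ici (μ := volume) ha).integral_tendsto_of_countably_generated
    (pv_integrable g lam)
  refine this.congr' ?_
  filter_upwards [self_mem_nhdsWithin] with ε hε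
  rw [pv_trunc g lam ε hε, Measure.restrict_restrict measurableSet_Ici,
    Set.inter_eq_left.2 (Set.Ici_subset_Ioi.2 (Set.mem_Ioi.1 hε))]

lemma pv_iter (g : SchwartzMap ℝ ℝ) (k : ℕ) : ∃ h : SchwartzMap ℝ ℝ,
    iteratedDeriv k g = h ∧ iteratedDeriv k (pvInt g) = pvInt h := by
  induction k with
  | zero => exact ⟨g, by simp, by simp⟩
  | succ k ih =>
    obtain ⟨h, h1, h2⟩ := ih
    refine ⟨SchwartzMap.derivCLM ℝ ℝ h, ?_, ?_⟩
    · rw [iteratedDeriv_succ, h1]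
      rfl
    · rw [iteratedDeriv_succ, h2]
      exact funext fun x => (pv_hasDerivAt h x).deriv

/-- For a Schwartz function `f`, the Cauchy principal value `γ(f,·)` is smooth and its
`k`-th derivative is the principal value of the `k`-th derivative of `f`. -/
theorem principal_value_smooth_and_deriv (f : SchwartzMap ℝ ℝ) (γ : ℝ → ℝ)
    (hγ : ∀ lam : ℝ,
      Tendsto (fun ε : ℝ => ∫ x in {x : ℝ | ε ≤ |x - lam|}, f x / (x - lam))
        (nhdsWithin 0 (Set.Ioi 0)) (nhds (γ lam))) :
    ContDiff ℝ (⊤ : ℕ∞) γ ∧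
      ∀ (k : ℕ) (lam : ℝ),
        Tendsto
          (fun ε : ℝ =>
            ∫ x in {x : ℝ | ε ≤ |x - lam|}, iteratedDeriv k (f : ℝ → ℝ) x / (x - lam))
          (nhdsWithin 0 (Set.Ioi 0)) (nhds (iteratedDeriv k γ lam)) := by
  have hγ' : γ = pvInt f := funext fun lam => tendsto_nhds_unique (hγ lam) (pv_tendsto f lam)
  subst hγ'
  constructor
  · refine contDiff_of_differentiable_iteratedDeriv fun m _ => ?_
    obtain ⟨h, -, h2⟩ := pv_iter f m
    rw [h2]
    exact fun x => (pv_hasDerivAt h x).differentiableAt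
  · intro k lam
    obtain ⟨h, h1, h2⟩ := pv_iter f k
    rw [h1, h2]
    exact pv_tendsto h lam
end

section
/- Let f ∈ 𝒮(ℝ). Then for every λ ∈ ℝ, lim_{ε→0⁺} ∫_ℝ f(x)/(x - (λ ± iε)) dx = γ(f,λ) ± iπf(λ), where γ(f,λ) is the Cauchy principal value of ∫ f(x)/(x-λ) dx, and the convergence is uniform for λ in compact subsets of ℝ. -/
open Filter MeasureTheory

theorem pp_kernel_integrable {ε : ℝ} (hε : 0 < ε) :
    Integrable (fun t : ℝ => ε / (t ^ 2 + ε ^ 2)) := by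
  have h := (integrable_inv_one_add_sq.comp_mul_left' (inv_ne_zero hε.ne')).const_mul ε⁻¹
  refine h.congr (Eventually.of_forall fun t => ?_)
  have : 0 < t ^ 2 + ε ^ 2 := by positivity
  have h2 : 0 < 1 + (ε⁻¹ * t) ^ 2 := by positivity
  simp only
  rw [← div_eq_mul_inv, div_eq_div_iff h2.ne' this.ne']
  field_simp
  ring

theorem pp_scale {ε : ℝ} (hε : 0 < ε) (g : ℝ → ℝ) :
    ∫ t, g t * (ε / (t ^ 2 + ε ^ 2)) = ∫ s, g (ε * s) * (1 + s ^ 2)⁻¹ := by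
  have h := Measure.integral_comp_mul_left (fun t => ε * (g t * (ε / (t ^ 2 + ε ^ 2)))) ε
  rw [integral_const_mul, integral_const_mul, smul_eq_mul, abs_of_pos (inv_pos.2 hε), ← mul_assoc,
    inv_mul_cancel₀ hε.ne', one_mul] at h
  rw [← h, ← integral_const_mul]
  congr 1
  ext s
  have h2 : 0 < 1 + s ^ 2 := by positivity
  have h3 : (ε * s) ^ 2 + ε ^ 2 = ε ^ 2 * (1 + s ^ 2) := by ring
  rw [h3]
  field_simp

theorem pp_kernel_integral {ε : ℝ} (hε : 0 < ε) :
    ∫ t : ℝ, ε / (t ^ 2 + ε ^ 2) = Real.pi := by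
  have h := pp_scale hε (fun _ => 1)
  simp only [one_mul] at h
  rw [h, integral_univ_inv_one_add_sq]

theorem pp_symm (k : ℝ → ℝ) (hk : Integrable k) :
    ∫ t, k t = ∫ t, (k t + k (-t)) / 2 := by
  rw [integral_div, integral_add hk hk.comp_neg, integral_neg_eq_self]
  ring

theorem pp_int_re {ε : ℝ} (hε : 0 < ε) (g : ℝ → ℝ) (hg : Integrable g) :
    Integrable (fun t => g t * (t / (t ^ 2 + ε ^ 2))) := by
  refine hg.mul_bdd (c := 1 / ε) ?_ (Eventually.of_forall fun t => ?_)
  · exact (by fun_prop : Measurable (fun t : ℝ => t / (t ^ 2 + ε ^ 2))).aestronglyMeasurable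
  · have : 0 < t ^ 2 + ε ^ 2 := by positivity
    rw [Real.norm_eq_abs, abs_div, abs_of_pos this, div_le_div_iff₀ this hε]
    nlinarith [sq_abs t, sq_nonneg (|t| - ε), abs_nonneg t, sq_nonneg t, sq_nonneg ε]

theorem pp_int_im {ε : ℝ} (hε : 0 < ε) (g : ℝ → ℝ) (hg : Integrable g) :
    Integrable (fun t => g t * (ε / (t ^ 2 + ε ^ 2))) := by
  refine hg.mul_bdd (c := 1 / ε) ?_ (Eventually.of_forall fun t => ?_)
  · exact (by fun_prop : Measurable (fun t : ℝ => ε / (t ^ 2 + ε ^ 2))).aestronglyMeasurable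
  · have : 0 < t ^ 2 + ε ^ 2 := by positivity
    rw [Real.norm_eq_abs, abs_div, abs_of_pos this, abs_of_pos hε, div_le_div_iff₀ this hε]
    nlinarith [sq_nonneg t]

theorem pp_real (g : ℝ → ℝ) (hg : Integrable g) (hgm : Measurable g) (L : ℝ) (hL : 0 ≤ L)
    (hLip : ∀ s t, |g s - g t| ≤ L * |s - t|) (c : ℝ)
    (hc : Tendsto (fun δ : ℝ => ∫ t in {t : ℝ | δ ≤ |t|}, g t / t)
      (nhdsWithin 0 (Set.Ioi 0)) (nhds c)) (ε : ℝ) (hε : 0 < ε) :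
    |(∫ t, g t * (t / (t ^ 2 + ε ^ 2))) - c| ≤ L * Real.pi * ε := by
  set h : ℝ → ℝ := fun t => (g t - g (-t)) / (2 * t) with hh
  have hhm : Measurable h := by
    have : Measurable fun t => g (-t) := hgm.comp measurable_neg
    fun_prop
  have hb : ∀ t, |h t| ≤ L := by
    intro t
    rcases eq_or_ne t 0 with rfl | ht
    · simpa [hh] using hL
    · have h1 := hLip t (-t)
      have h2 : 0 < |2 * t| := by positivity
      simp only [hh]
      rw [abs_div, div_le_iff₀ h2]
      rwa [sub_neg_eq_add, ← two_mul] at h1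
  have hi : Integrable h := by
    have hbd : Integrable (fun t => (Set.Icc (-1 : ℝ) 1).indicator (fun _ => L) t
        + (|g t| + |g (-t)|)) := by
      refine Integrable.add ?_ (hg.abs.add hg.comp_neg.abs)
      rw [integrable_indicator_iff measurableSet_Icc]
      exact integrableOn_const (by simp)
    refine hbd.mono' hhm.aestronglyMeasurable (Eventually.of_forall fun t => ?_)
    rw [Real.norm_eq_abs]
    by_cases ht : t ∈ Set.Icc (-1 : ℝ) 1
    · rw [Set.indicator_of_mem ht]
      have := hb t
      have := abs_nonneg (g t)
      have := abs_nonneg (g (-t))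
      linarith
    · rw [Set.indicator_of_notMem ht, zero_add]
      have h1 : 1 < |t| := by
        by_contra hcon
        exact ht (abs_le.1 (not_lt.1 hcon))
      simp only [hh]
      rw [abs_div, abs_mul, abs_two, div_le_iff₀ (by positivity)]
      have h3 := abs_sub (g t) (g (-t))
      have := abs_nonneg (g t)
      have := abs_nonneg (g (-t))
      nlinarith
  have hS : ∀ δ : ℝ, MeasurableSet {t : ℝ | δ ≤ |t|} := fun δ =>
    measurableSet_le measurable_const (by fun_prop)
  have hcint : c = ∫ t, h t := by
    refine tendsto_nhds_unique hc ?_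
    have hlim : Tendsto (fun δ : ℝ => ∫ t, {t : ℝ | δ ≤ |t|}.indicator h t)
        (nhdsWithin 0 (Set.Ioi 0)) (nhds (∫ t, h t)) := by
      refine tendsto_integral_filter_of_dominated_convergence (fun t => |h t|) ?_ ?_ hi.abs ?_
      · exact Eventually.of_forall fun δ => (hhm.indicator (hS δ)).aestronglyMeasurable
      · exact Eventually.of_forall fun δ => Eventually.of_forall fun t =>
          norm_indicator_le_norm_self h t
      · refine Eventually.of_forall fun t => ?_
        rcases eq_or_ne t 0 with rfl | ht
        · have h0 : h 0 = 0 := by simp [hh]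
          refine tendsto_const_nhds.congr fun δ => ?_
          by_cases hm : (0 : ℝ) ∈ {t : ℝ | δ ≤ |t|}
          · rw [Set.indicator_of_mem hm]
          · rw [Set.indicator_of_notMem hm, h0]
        · refine tendsto_const_nhds.congr' ?_
          have : ∀ᶠ δ : ℝ in nhdsWithin 0 (Set.Ioi 0), δ < |t| :=
            nhdsWithin_le_nhds (eventually_lt_nhds (abs_pos.2 ht))
          filter_upwards [this] with δ hδ
          rw [Set.indicator_of_mem]
          exact hδ.le
    refine hlim.congr' ?_
    filter_upwards [self_mem_nhdsWithin] with δ hδ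
    have hδ : 0 < δ := hδ
    rw [← integral_indicator (hS δ)]
    have hki : Integrable ({t : ℝ | δ ≤ |t|}.indicator fun t => g t / t) := by
      refine (hg.abs.div_const δ).mono'
        ((hgm.div measurable_id).indicator (hS δ)).aestronglyMeasurable
        (Eventually.of_forall fun t => ?_)
      by_cases hm : t ∈ {t : ℝ | δ ≤ |t|}
      · rw [Set.indicator_of_mem hm, Real.norm_eq_abs, abs_div]
        exact div_le_div_of_nonneg_left (abs_nonneg _) hδ hm
      · rw [Set.indicator_of_notMem hm, norm_zero]
        positivity
    rw [pp_symm _ hki]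
    congr 1
    ext t
    have hneg : -t ∈ {t : ℝ | δ ≤ |t|} ↔ t ∈ {t : ℝ | δ ≤ |t|} := by simp
    by_cases hm : t ∈ {t : ℝ | δ ≤ |t|}
    · rw [Set.indicator_of_mem hm, Set.indicator_of_mem hm, Set.indicator_of_mem (hneg.2 hm)]
      have ht : t ≠ 0 := by
        rintro rfl
        simp at hm
        linarith
      simp only [hh]
      field_simp
      ring
    · rw [Set.indicator_of_notMem hm, Set.indicator_of_notMem hm,
        Set.indicator_of_notMem (fun h => hm (hneg.1 h))]
      simp
  have hR : ∫ t, g t * (t / (t ^ 2 + ε ^ 2)) = ∫ t, (h t - h t * (ε / (t ^ 2 + ε ^ 2)) * ε) := by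
    rw [pp_symm _ (pp_int_re hε g hg)]
    congr 1
    ext t
    have hp : 0 < t ^ 2 + ε ^ 2 := by positivity
    rcases eq_or_ne t 0 with rfl | ht
    · simp [hh]
    · simp only [hh, neg_sq]
      field_simp
      ring
  rw [hR, integral_sub hi ((pp_int_im hε h hi).mul_const ε), ← hcint, sub_sub_cancel_left, abs_neg,
    integral_mul_const, abs_mul, abs_of_pos hε]
  refine mul_le_mul_of_nonneg_right ?_ hε.le
  rw [← pp_kernel_integral hε, ← integral_const_mul, ← Real.norm_eq_abs]
  refine norm_integral_le_of_norm_le ((pp_kernel_integrable hε).const_mul L)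
    (Eventually.of_forall fun t => ?_)
  have hp : 0 < ε / (t ^ 2 + ε ^ 2) := by positivity
  rw [norm_mul, Real.norm_eq_abs, Real.norm_eq_abs, abs_of_pos hp]
  exact mul_le_mul_of_nonneg_right (hb t) hp.le

theorem pp_imag (g : ℝ → ℝ) (hgc : Continuous g) (L M : ℝ)
    (hLip : ∀ s t, |g s - g t| ≤ L * |s - t|) (hM : ∀ t, |g t| ≤ M) (ε : ℝ) (hε : 0 < ε) :
    |(∫ t, g t * (ε / (t ^ 2 + ε ^ 2))) - Real.pi * g 0| ≤
      ∫ s, min (L * (ε * |s|)) (2 * M) * (1 + s ^ 2)⁻¹ := by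
  have hL : 0 ≤ L := by simpa using (abs_nonneg _).trans (hLip 1 0)
  have hM0 : 0 ≤ M := (abs_nonneg _).trans (hM 0)
  have h1 : Integrable (fun s : ℝ => g (ε * s) * (1 + s ^ 2)⁻¹) := by
    refine integrable_inv_one_add_sq.bdd_mul (c := M) ?_ (Eventually.of_forall fun s => hM _)
    exact (by fun_prop : Continuous fun s => g (ε * s)).aestronglyMeasurable
  have h2 : Integrable (fun s : ℝ => min (L * (ε * |s|)) (2 * M) * (1 + s ^ 2)⁻¹) := by
    refine integrable_inv_one_add_sq.bdd_mul (c := 2 * M) ?_ (Eventually.of_forall fun s => ?_)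
    · exact (by fun_prop : Continuous fun s : ℝ => min (L * (ε * |s|)) (2 * M)).aestronglyMeasurable
    · rw [Real.norm_eq_abs, abs_of_nonneg (by positivity)]
      exact min_le_right _ _
  rw [pp_scale hε, ← integral_univ_inv_one_add_sq, ← integral_mul_const,
    ← integral_sub h1 (integrable_inv_one_add_sq.mul_const _), ← Real.norm_eq_abs]
  refine norm_integral_le_of_norm_le h2 (Eventually.of_forall fun s => ?_)
  have hp : 0 < (1 + s ^ 2)⁻¹ := by positivity
  have he : g (ε * s) * (1 + s ^ 2)⁻¹ - (1 + s ^ 2)⁻¹ * g 0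
    = (g (ε * s) - g 0) * (1 + s ^ 2)⁻¹ := by ring
  rw [he, norm_mul, Real.norm_eq_abs, Real.norm_eq_abs, abs_of_pos hp]
  refine mul_le_mul_of_nonneg_right (le_min ?_ ?_) hp.le
  · have := hLip (ε * s) 0
    rwa [sub_zero, abs_mul, abs_of_pos hε] at this
  · have := abs_sub (g (ε * s)) (g 0)
    linarith [hM (ε * s), hM 0]

theorem pp_rate (L M : ℝ) (hL : 0 ≤ L) (hM : 0 ≤ M) :
    Tendsto (fun ε : ℝ => L * Real.pi * ε +
      ∫ s, min (L * (ε * |s|)) (2 * M) * (1 + s ^ 2)⁻¹) (nhdsWithin 0 (Set.Ioi 0)) (nhds 0) := by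
  have hid : Tendsto (fun ε : ℝ => ε) (nhdsWithin 0 (Set.Ioi 0)) (nhds 0) := nhdsWithin_le_nhds
  have h1 : Tendsto (fun ε : ℝ => L * Real.pi * ε) (nhdsWithin 0 (Set.Ioi 0)) (nhds 0) := by
    simpa using hid.const_mul (L * Real.pi)
  have h2 : Tendsto (fun ε : ℝ => ∫ s, min (L * (ε * |s|)) (2 * M) * (1 + s ^ 2)⁻¹)
      (nhdsWithin 0 (Set.Ioi 0)) (nhds (∫ _ : ℝ, (0 : ℝ))) := by
    refine tendsto_integral_filter_of_dominated_convergence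
      (fun s => 2 * M * (1 + s ^ 2)⁻¹) ?_ ?_ (integrable_inv_one_add_sq.const_mul _) ?_
    · exact Eventually.of_forall fun ε => (by fun_prop :
        Measurable fun s : ℝ => min (L * (ε * |s|)) (2 * M) * (1 + s ^ 2)⁻¹).aestronglyMeasurable
    · filter_upwards [self_mem_nhdsWithin] with ε hε
      have hε : 0 < ε := hε
      refine Eventually.of_forall fun s => ?_
      rw [Real.norm_eq_abs, abs_of_nonneg (by positivity)]
      exact mul_le_mul_of_nonneg_right (min_le_right _ _) (by positivity)
    · refine Eventually.of_forall fun s => ?_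
      have hc : Continuous fun ε : ℝ => min (L * (ε * |s|)) (2 * M) * (1 + s ^ 2)⁻¹ := by fun_prop
      have := hc.tendsto 0
      simp only [zero_mul, mul_zero] at this
      rw [min_eq_left (by positivity), zero_mul] at this
      exact this.mono_left nhdsWithin_le_nhds
  simpa using h1.add h2

theorem pp_split (g : ℝ → ℝ) (hg : Integrable g) (ε : ℝ) (hε : 0 < ε) :
    ∫ t : ℝ, (g t : ℂ) / ((t : ℂ) - Complex.I * (ε : ℂ)) =
      ((∫ t, g t * (t / (t ^ 2 + ε ^ 2)) : ℝ) : ℂ) +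
        Complex.I * ((∫ t, g t * (ε / (t ^ 2 + ε ^ 2)) : ℝ) : ℂ) := by
  rw [← integral_complex_ofReal, ← integral_complex_ofReal, ← integral_const_mul,
    ← integral_add (pp_int_re hε g hg).ofReal ((pp_int_im hε g hg).ofReal.const_mul _)]
  congr 1
  ext t
  have hp : 0 < t ^ 2 + ε ^ 2 := by positivity
  have hp' : ((t : ℂ) ^ 2 + (ε : ℂ) ^ 2) ≠ 0 := by exact_mod_cast hp.ne'
  have hfac : ((t : ℂ) - Complex.I * ε) * ((t : ℂ) + Complex.I * ε) = (t : ℂ) ^ 2 + (ε : ℂ) ^ 2 := by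
    linear_combination (-(ε : ℂ) ^ 2) * Complex.I_sq
  have hq : ((t : ℂ) - Complex.I * ε) ≠ 0 := by
    intro h0
    rw [h0, zero_mul] at hfac
    exact hp' hfac.symm
  push_cast
  rw [div_eq_iff hq]
  have : ((g t : ℂ) * (t / ((t : ℂ) ^ 2 + (ε : ℂ) ^ 2)) +
      Complex.I * ((g t : ℂ) * (ε / ((t : ℂ) ^ 2 + (ε : ℂ) ^ 2)))) * ((t : ℂ) - Complex.I * ε)
      = (g t : ℂ) * ((((t : ℂ) - Complex.I * ε) * ((t : ℂ) + Complex.I * ε)) /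
        ((t : ℂ) ^ 2 + (ε : ℂ) ^ 2)) := by ring
  rw [this, hfac, div_self hp', mul_one]

theorem pp_main (f : SchwartzMap ℝ ℝ) (γ : ℝ → ℝ)
    (hγ : ∀ lam : ℝ,
      Tendsto (fun ε : ℝ => ∫ x in {x : ℝ | ε ≤ |x - lam|}, f x / (x - lam))
        (nhdsWithin 0 (Set.Ioi 0)) (nhds (γ lam))) :
    ∃ b : ℝ → ℝ, Tendsto b (nhdsWithin 0 (Set.Ioi 0)) (nhds 0) ∧ ∀ ε : ℝ, 0 < ε → ∀ lam : ℝ,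
      ‖(∫ x : ℝ, (f x : ℂ) / ((x : ℂ) - ((lam : ℂ) + Complex.I * (ε : ℂ)))) -
        ((γ lam : ℂ) + Complex.I * (Real.pi : ℂ) * (f lam : ℂ))‖ ≤ b ε := by
  set M := SchwartzMap.seminorm ℝ 0 0 f
  set L := SchwartzMap.seminorm ℝ 0 0 (SchwartzMap.derivCLM ℝ ℝ f)
  have hM0 : 0 ≤ M := apply_nonneg _ _
  have hL0 : 0 ≤ L := apply_nonneg _ _
  have hM : ∀ t, |f t| ≤ M := fun t => SchwartzMap.norm_le_seminorm ℝ f t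
  have hLip : ∀ s t, |f s - f t| ≤ L * |s - t| := by
    intro s t
    refine Convex.norm_image_sub_le_of_norm_deriv_le (s := Set.univ) (f := f)
      (fun x _ => f.differentiableAt) (fun x _ => ?_) convex_univ (Set.mem_univ t) (Set.mem_univ s)
    rw [← SchwartzMap.derivCLM_apply ℝ]
    exact SchwartzMap.norm_le_seminorm ℝ _ x
  refine ⟨_, pp_rate L M hL0 hM0, fun ε hε lam => ?_⟩
  have hgi : Integrable fun t => f (t + lam) := (f.integrable (μ := volume)).comp_add_right lam
  have hgc : Continuous fun t => f (t + lam) := f.continuous.comp (by fun_prop)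
  have hgl : ∀ s t, |f (s + lam) - f (t + lam)| ≤ L * |s - t| := by
    intro s t
    simpa using hLip (s + lam) (t + lam)
  have hc : Tendsto (fun δ : ℝ => ∫ t in {t : ℝ | δ ≤ |t|}, f (t + lam) / t)
      (nhdsWithin 0 (Set.Ioi 0)) (nhds (γ lam)) := by
    refine (hγ lam).congr fun δ => ?_
    rw [← integral_indicator (measurableSet_le measurable_const (by fun_prop)),
      ← integral_indicator (measurableSet_le measurable_const (by fun_prop)),
      ← integral_add_right_eq_self _ lam]
    congr 1
    ext t
    simp [Set.indicator]
  have hA := pp_real _ hgi hgc.measurable L hL0 hgl _ hc ε hε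
  have hB := pp_imag _ hgc L M hgl (fun t => hM _) ε hε
  have hI : ∫ x : ℝ, (f x : ℂ) / ((x : ℂ) - ((lam : ℂ) + Complex.I * (ε : ℂ))) =
      ∫ t : ℝ, ((f (t + lam) : ℝ) : ℂ) / ((t : ℂ) - Complex.I * (ε : ℂ)) := by
    rw [← integral_add_right_eq_self _ lam]
    congr 1
    ext t
    congr 1
    push_cast
    ring
  rw [hI, pp_split _ hgi ε hε]
  simp only [zero_add] at hB
  set A := ∫ t, f (t + lam) * (t / (t ^ 2 + ε ^ 2))
  set B := ∫ t, f (t + lam) * (ε / (t ^ 2 + ε ^ 2))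
  have he : (A : ℂ) + Complex.I * (B : ℂ) - ((γ lam : ℂ) + Complex.I * Real.pi * (f lam : ℂ)) =
      ((A - γ lam : ℝ) : ℂ) + Complex.I * ((B - Real.pi * f lam : ℝ) : ℂ) := by
    push_cast
    ring
  rw [he]
  refine (norm_add_le _ _).trans (add_le_add ?_ ?_)
  · rwa [Complex.norm_real, Real.norm_eq_abs]
  · rwa [norm_mul, Complex.norm_I, one_mul, Complex.norm_real, Real.norm_eq_abs]

theorem pp_conj (f : SchwartzMap ℝ ℝ) (c ε lam : ℝ) :
    ‖(∫ x : ℝ, (f x : ℂ) / ((x : ℂ) - ((lam : ℂ) - Complex.I * (ε : ℂ)))) -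
        ((c : ℂ) - Complex.I * (Real.pi : ℂ) * (f lam : ℂ))‖ =
    ‖(∫ x : ℝ, (f x : ℂ) / ((x : ℂ) - ((lam : ℂ) + Complex.I * (ε : ℂ)))) -
        ((c : ℂ) + Complex.I * (Real.pi : ℂ) * (f lam : ℂ))‖ := by
  rw [← Complex.norm_conj, map_sub, ← integral_conj]
  simp [sub_eq_add_neg]

/-- Plemelj–Privalov theorem for Schwartz functions: the boundary values of the Cauchy
transform are `γ(f,λ) ± iπ f(λ)`, uniformly for `λ` in compact sets. -/
theorem plemelj_privalov (f : SchwartzMap ℝ ℝ) (γ : ℝ → ℝ)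
    (hγ : ∀ lam : ℝ,
      Tendsto (fun ε : ℝ => ∫ x in {x : ℝ | ε ≤ |x - lam|}, f x / (x - lam))
        (nhdsWithin 0 (Set.Ioi 0)) (nhds (γ lam))) :
    (∀ lam : ℝ,
      Tendsto (fun ε : ℝ => ∫ x : ℝ, (f x : ℂ) / ((x : ℂ) - ((lam : ℂ) + Complex.I * (ε : ℂ))))
        (nhdsWithin 0 (Set.Ioi 0))
        (nhds ((γ lam : ℂ) + Complex.I * (Real.pi : ℂ) * (f lam : ℂ))) ∧
      Tendsto (fun ε : ℝ => ∫ x : ℝ, (f x : ℂ) / ((x : ℂ) - ((lam : ℂ) - Complex.I * (ε : ℂ))))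
        (nhdsWithin 0 (Set.Ioi 0))
        (nhds ((γ lam : ℂ) - Complex.I * (Real.pi : ℂ) * (f lam : ℂ)))) ∧
    ∀ K : Set ℝ, IsCompact K →
      TendstoUniformlyOn
        (fun (ε : ℝ) (lam : ℝ) =>
          ∫ x : ℝ, (f x : ℂ) / ((x : ℂ) - ((lam : ℂ) + Complex.I * (ε : ℂ))))
        (fun lam => (γ lam : ℂ) + Complex.I * (Real.pi : ℂ) * (f lam : ℂ))
        (nhdsWithin 0 (Set.Ioi 0)) K ∧
      TendstoUniformlyOn
        (fun (ε : ℝ) (lam : ℝ) =>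
          ∫ x : ℝ, (f x : ℂ) / ((x : ℂ) - ((lam : ℂ) - Complex.I * (ε : ℂ))))
        (fun lam => (γ lam : ℂ) - Complex.I * (Real.pi : ℂ) * (f lam : ℂ))
        (nhdsWithin 0 (Set.Ioi 0)) K := by
  obtain ⟨b, hb, hmain⟩ := pp_main f γ hγ
  have hU : TendstoUniformlyOn
        (fun (ε : ℝ) (lam : ℝ) =>
          ∫ x : ℝ, (f x : ℂ) / ((x : ℂ) - ((lam : ℂ) + Complex.I * (ε : ℂ))))
        (fun lam => (γ lam : ℂ) + Complex.I * (Real.pi : ℂ) * (f lam : ℂ))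
        (nhdsWithin 0 (Set.Ioi 0)) Set.univ := by
    rw [Metric.tendstoUniformlyOn_iff]
    intro r hr
    filter_upwards [self_mem_nhdsWithin, hb.eventually_lt_const hr] with ε hε hlt lam _
    rw [dist_comm, dist_eq_norm]
    exact (hmain ε hε lam).trans_lt hlt
  have hV : TendstoUniformlyOn
        (fun (ε : ℝ) (lam : ℝ) =>
          ∫ x : ℝ, (f x : ℂ) / ((x : ℂ) - ((lam : ℂ) - Complex.I * (ε : ℂ))))
        (fun lam => (γ lam : ℂ) - Complex.I * (Real.pi : ℂ) * (f lam : ℂ))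
        (nhdsWithin 0 (Set.Ioi 0)) Set.univ := by
    rw [Metric.tendstoUniformlyOn_iff]
    intro r hr
    filter_upwards [self_mem_nhdsWithin, hb.eventually_lt_const hr] with ε hε hlt lam _
    rw [dist_comm, dist_eq_norm, pp_conj]
    exact (hmain ε hε lam).trans_lt hlt
  exact ⟨fun lam => ⟨hU.tendsto_at (Set.mem_univ lam), hV.tendsto_at (Set.mem_univ lam)⟩,
    fun K _ => ⟨hU.mono (Set.subset_univ K), hV.mono (Set.subset_univ K)⟩⟩
end
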